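/- arXiv:2101.07502 — 3 statements merged into one kernel-verified Lean document; each statement's English description precedes it below -/
import Mathlib

section
/- The function f defined by f(x) = x·(1 − exp(−1/x)) is strictly increasing on the interval (0, ∞). -/
/-- The function `f(x) = x·(1 − exp(−1/x))` is strictly increasing on `(0, ∞)`. -/
theorem covert_f_strictMonoOn :
    StrictMonoOn (fun x : ℝ => x * (1 - Real.exp (-1 / x))) (Set.Ioi 0) := by
  intro a ha b hb hab
  rw [Set.mem_Ioi] at ha hb
  -- `-1 / b` is a strict convex combination of `-1 / a` and `0`
  have hconv := strictConvexOn_exp.2 (Set.mem_univ (-1 / a)) (Set.mem_univ 0)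
    (div_neg_of_neg_of_pos (by norm_num) ha).ne (div_pos ha hb)
    (sub_pos.2 ((div_lt_one hb).2 hab)) (add_sub_cancel (a / b) 1)
  have hcomb : (a / b) • (-1 / a) + (1 - a / b) • (0 : ℝ) = -1 / b := by
    simp only [smul_eq_mul]
    field_simp
    ring
  rw [hcomb, Real.exp_zero, smul_eq_mul, smul_eq_mul] at hconv
  have hmul := mul_lt_mul_of_pos_left hconv hb
  have hexpand : b * (a / b * Real.exp (-1 / a) + (1 - a / b) * 1)
      = a * Real.exp (-1 / a) + (b - a) := by
    field_simp
  rw [hexpand] at hmul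
  simp only [mul_sub, mul_one]
  linarith
end

section
/- Let σ² ∈ ℝ, Γ > 0 and a > 0, and define ξ : ℝ → ℝ piecewise by ξ(θ) = 1 for θ ≤ σ²; ξ(θ) = 1 + (a/Γ)·(exp(−(θ − σ²)/a) − 1) for σ² < θ ≤ σ² + Γ; and ξ(θ) = 1 − (a/Γ)·(exp(−(θ − σ² − Γ)/a) − exp(−(θ − σ²)/a)) for θ > σ² + Γ. Then for every θ ∈ ℝ, ξ(θ) ≥ ξ(σ² + Γ) = 1 + (a/Γ)·(exp(−Γ/a) − 1); i.e., the detection threshold θ* = Γ + σ² minimizes ξ and the minimum value equals 1 + (exp(−Γ/(a)) − 1)·(a/Γ). -/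
/-- Lemma 2 of the paper: the detection threshold `θ* = σ² + Γ` minimizes Willie's total
detection error rate `ξ`, and the minimum value equals `1 + (a/Γ)·(exp(−Γ/a) − 1)`. -/
theorem optimal_detection_threshold (σ2 Γ a : ℝ) (hΓ : 0 < Γ) (ha : 0 < a)
    (ξ : ℝ → ℝ)
    (hξ : ∀ θ : ℝ, ξ θ =
      if θ ≤ σ2 then 1
      else if θ ≤ σ2 + Γ then 1 + (a / Γ) * (Real.exp (-(θ - σ2) / a) - 1)
      else 1 - (a / Γ) * (Real.exp (-(θ - σ2 - Γ) / a) - Real.exp (-(θ - σ2) / a))) :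
    (∀ θ : ℝ, ξ θ ≥ ξ (σ2 + Γ)) ∧
    ξ (σ2 + Γ) = 1 + (a / Γ) * (Real.exp (-Γ / a) - 1) := by
  have hmin : ξ (σ2 + Γ) = 1 + (a / Γ) * (Real.exp (-Γ / a) - 1) := by
    rw [hξ, if_neg (by linarith), if_pos le_rfl, add_sub_cancel_left]
  refine ⟨fun θ => ?_, hmin⟩
  have hc : 0 ≤ a / Γ := by positivity
  have hE : Real.exp (-Γ / a) ≤ 1 :=
    Real.exp_le_one_iff.mpr (div_nonpos_of_nonpos_of_nonneg (by linarith) ha.le)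
  rw [hmin, hξ, ge_iff_le]
  split_ifs with h₁ h₂
  · nlinarith
  · have hle : Real.exp (-Γ / a) ≤ Real.exp (-(θ - σ2) / a) :=
      Real.exp_le_exp.mpr (div_le_div_of_nonneg_right (by linarith) ha.le)
    gcongr
  · have hu : Real.exp (-(θ - σ2 - Γ) / a) ≤ 1 :=
      Real.exp_le_one_iff.mpr (div_nonpos_of_nonpos_of_nonneg (by linarith) ha.le)
    have hmul : Real.exp (-(θ - σ2) / a) =
        Real.exp (-(θ - σ2 - Γ) / a) * Real.exp (-Γ / a) := by
      rw [← Real.exp_add]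
      ring_nf
    rw [hmul]
    linarith [mul_nonneg hc (mul_nonneg (sub_nonneg.mpr hE) (sub_nonneg.mpr hu))]
end

section
/- Let v > 0 and N > 0 be real numbers, let d satisfy 0 ≤ d < N·v, and let t ∈ [−1, 1]. Then N·v − d·t > 0, and the number N₄ := (N²·v² − d²)/(2·v·(N·v − d·t)) satisfies 0 < N₄ ≤ N and the law-of-cosines identity (N₄·v)² + d² − 2·N₄·v·d·t = (N − N₄)²·v². -/
/-- Proposition 1 of the paper: existence of the intermediate turning point. With `v > 0` the
per-slot flight distance, `N` the number of slots, `0 ≤ d < N·v` the initial–final distance and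
`t = cos` of the turning angle, the quantity `N₄ = (N²v² − d²)/(2v(Nv − d·t))` is well defined,
satisfies `0 < N₄ ≤ N`, and the law-of-cosines identity holds. -/
theorem intermediate_point_exists (v N d t : ℝ)
    (hv : 0 < v) (hN : 0 < N) (hd : 0 ≤ d) (hdN : d < N * v) (ht : t ∈ Set.Icc (-1 : ℝ) 1) :
    0 < N * v - d * t ∧
    (0 < (N ^ 2 * v ^ 2 - d ^ 2) / (2 * v * (N * v - d * t)) ∧
      (N ^ 2 * v ^ 2 - d ^ 2) / (2 * v * (N * v - d * t)) ≤ N) ∧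
    ((N ^ 2 * v ^ 2 - d ^ 2) / (2 * v * (N * v - d * t)) * v) ^ 2 + d ^ 2 -
        2 * ((N ^ 2 * v ^ 2 - d ^ 2) / (2 * v * (N * v - d * t))) * v * d * t =
      (N - (N ^ 2 * v ^ 2 - d ^ 2) / (2 * v * (N * v - d * t))) ^ 2 * v ^ 2 := by
  obtain ⟨-, ht1⟩ := ht
  have hNv : 0 < N * v := mul_pos hN hv
  have hpos : 0 < N * v - d * t := by nlinarith [mul_nonneg hd (sub_nonneg.2 ht1)]
  have hden : 0 < 2 * v * (N * v - d * t) := by positivity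
  refine ⟨hpos, ⟨div_pos ?_ hden, ?_⟩, ?_⟩
  · nlinarith
  · rw [div_le_iff₀ hden]
    nlinarith [sq_nonneg (N * v - d), mul_nonneg (mul_nonneg hNv.le hd) (sub_nonneg.2 ht1)]
  · have hx := div_mul_cancel₀ (N ^ 2 * v ^ 2 - d ^ 2) hden.ne'
    linear_combination hx
end
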